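/- Let n and m be nonnegative integers with m ≤ 2^n. There exists a family 𝓕 of subsets of [n] with |𝓕| = m and |𝓕↕| = Φ(n,m) that is both convex and strongly shifted. -/

import Mathlib

open Finset

/-- The ground set `[n] = {1, …, n}`. -/
def groundSet (n : ℕ) : Finset ℕ := Finset.Icc 1 n

/-- The up-closure `𝓕↑` of a family `F` with respect to ground set `X`. -/
def upClo (X : Finset ℕ) (F : Finset (Finset ℕ)) : Finset (Finset ℕ) :=
  X.powerset.filter (fun S => ∃ A ∈ F, A ⊆ S)

/-- The down-closure `𝓕↓` of a family `F` with respect to ground set `X`. -/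
def downClo (X : Finset ℕ) (F : Finset (Finset ℕ)) : Finset (Finset ℕ) :=
  X.powerset.filter (fun S => ∃ A ∈ F, S ⊆ A)

/-- `𝓕↕ = 𝓕↑ ∪ 𝓕↓` with respect to ground set `X`. -/
def udClo (X : Finset ℕ) (F : Finset (Finset ℕ)) : Finset (Finset ℕ) :=
  upClo X F ∪ downClo X F

/-- `Φ(n,m)`: the minimum of `|𝓕↕|` over families `𝓕 ⊆ 2^[n]` with `|𝓕| = m`,
closures taken w.r.t. the ground set `[n]`. -/
noncomputable def Phi (n m : ℕ) : ℕ :=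
  sInf {k | ∃ F : Finset (Finset ℕ),
    F ⊆ (groundSet n).powerset ∧ F.card = m ∧ (udClo (groundSet n) F).card = k}

/-- A family is convex (w.r.t. ground set `X`) if `𝓕↑ ∩ 𝓕↓ = 𝓕`. -/
def IsConvex (X : Finset ℕ) (F : Finset (Finset ℕ)) : Prop :=
  upClo X F ∩ downClo X F = F

/-- The shift `S^𝓕_{I,J}(A)` of a single set `A ∈ 𝓕`. -/
def shiftSet (F : Finset (Finset ℕ)) (I J A : Finset ℕ) : Finset ℕ :=
  if I ∩ A = ∅ ∧ J ⊆ A ∧ (A \ J) ∪ I ∉ F then (A \ J) ∪ I else A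

/-- The shifted family `S_{I,J}(𝓕)`. -/
def shiftFam (I J : Finset ℕ) (F : Finset (Finset ℕ)) : Finset (Finset ℕ) :=
  F.image (shiftSet F I J)

/-- A family of subsets of `[n]` is strongly shifted if `S_{I,J}(𝓕) = 𝓕` for all
nonempty disjoint `I, J ⊆ [n]` with `max I < min J`. -/
def StronglyShifted (n : ℕ) (F : Finset (Finset ℕ)) : Prop :=
  ∀ I J : Finset ℕ, I ⊆ groundSet n → J ⊆ groundSet n →
    ∀ (hI : I.Nonempty) (hJ : J.Nonempty),
      Disjoint I J → I.max' hI < J.min' hJ → shiftFam I J F = F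

/-- `F` is closed under replacing `J` by `I` in members that contain `J` and avoid `I`. -/
def ShiftStable (I J : Finset ℕ) (F : Finset (Finset ℕ)) : Prop :=
  ∀ A ∈ F, Disjoint I A → J ⊆ A → (A \ J) ∪ I ∈ F

/-- The pairs `(I, J)` that occur in the definition of a strongly shifted family. -/
structure IsShiftPair (n : ℕ) (I J : Finset ℕ) : Prop where
  left_subset : I ⊆ groundSet n
  right_subset : J ⊆ groundSet n
  left_nonempty : I.Nonempty
  right_nonempty : J.Nonempty
  lt : ∀ i ∈ I, ∀ j ∈ J, i < j

lemma IsShiftPair.mono {n : ℕ} {I J I' J' : Finset ℕ} (h : IsShiftPair n I J)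
    (hI : I' ⊆ I) (hJ : J' ⊆ J) (hI' : I'.Nonempty) (hJ' : J'.Nonempty) :
    IsShiftPair n I' J' :=
  ⟨hI.trans h.left_subset, hJ.trans h.right_subset, hI', hJ',
    fun i hi j hj => h.lt i (hI hi) j (hJ hj)⟩

lemma IsShiftPair.disjoint {n : ℕ} {I J : Finset ℕ} (h : IsShiftPair n I J) : Disjoint I J :=
  Finset.disjoint_left.2 fun i hi hj => lt_irrefl _ (h.lt i hi i hj)

lemma stronglyShifted_of_shiftStable {n : ℕ} {F : Finset (Finset ℕ)}
    (h : ∀ I J, IsShiftPair n I J → ShiftStable I J F) : StronglyShifted n F := by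
  intro I J hIX hJX hI hJ _ hlt
  have hs : ShiftStable I J F := h I J ⟨hIX, hJX, hI, hJ, fun i hi j hj =>
    (I.le_max' i hi).trans_lt (hlt.trans_le (J.min'_le j hj))⟩
  have hid : ∀ A ∈ F, shiftSet F I J A = A := fun A hA => by
    unfold shiftSet
    rw [if_neg]
    rintro ⟨h1, h2, h3⟩
    exact h3 (hs A hA (Finset.disjoint_iff_inter_eq_empty.2 h1) h2)
  ext X
  simp only [shiftFam, Finset.mem_image]
  constructor
  · rintro ⟨A, hA, rfl⟩
    rwa [hid A hA]
  · exact fun hX => ⟨X, hX, hid X hX⟩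

lemma mem_shiftFam {I J : Finset ℕ} (hI : I.Nonempty) (hIJ : Disjoint I J)
    {F : Finset (Finset ℕ)} {X : Finset ℕ} :
    X ∈ shiftFam I J F ↔
      (X ∈ F ∧ (Disjoint I X → J ⊆ X → (X \ J) ∪ I ∈ F)) ∨
      (I ⊆ X ∧ Disjoint J X ∧ (X \ I) ∪ J ∈ F) := by
  simp only [shiftFam, Finset.mem_image, shiftSet, ← Finset.disjoint_iff_inter_eq_empty]
  constructor
  · rintro ⟨A, hA, rfl⟩
    split_ifs with h
    · obtain ⟨h1, h2, h3⟩ := h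
      right
      have : ((A \ J ∪ I) \ I) ∪ J = A := by
        ext x
        rw [Finset.disjoint_left] at h1
        rw [Finset.disjoint_left] at hIJ
        grind
      refine ⟨Finset.subset_union_right, ?_, by rwa [this]⟩
      rw [Finset.disjoint_left] at hIJ ⊢
      grind
    · left
      exact ⟨hA, fun h1 h2 => by_contra fun h3 => h ⟨h1, h2, h3⟩⟩
  · have hfix : ∀ X ∈ F, (Disjoint I X → J ⊆ X → (X \ J) ∪ I ∈ F) →
        ∃ a ∈ F, (if Disjoint I a ∧ J ⊆ a ∧ a \ J ∪ I ∉ F then a \ J ∪ I else a) = X :=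
      fun X hX h => ⟨X, hX, if_neg fun h' => h'.2.2 (h h'.1 h'.2.1)⟩
    rintro (⟨hX, h⟩ | ⟨h1, h2, h3⟩)
    · exact hfix X hX h
    · by_cases hX : X ∈ F
      · refine hfix X hX fun h4 => ?_
        obtain ⟨i, hi⟩ := hI
        exact absurd (h1 hi) (Finset.disjoint_left.1 h4 hi)
      · have hX' : (X \ I ∪ J) \ J ∪ I = X := by
          ext x
          rw [Finset.disjoint_left] at h2
          grind
        have hd : Disjoint I (X \ I ∪ J) :=
          Finset.disjoint_union_right.2 ⟨Finset.disjoint_sdiff, hIJ⟩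
        exact ⟨_, h3, by rw [hX', if_pos ⟨hd, Finset.subset_union_right, hX⟩]⟩

lemma shiftFam_mono {I J : Finset ℕ} (hI : I.Nonempty) (hIJ : Disjoint I J)
    {F G : Finset (Finset ℕ)} (h : F ⊆ G) : shiftFam I J F ⊆ shiftFam I J G := by
  intro X
  rw [mem_shiftFam hI hIJ, mem_shiftFam hI hIJ]
  rintro (⟨h1, h2⟩ | ⟨h1, h2, h3⟩)
  · exact Or.inl ⟨h h1, fun a b => h (h2 a b)⟩
  · exact Or.inr ⟨h1, h2, h h3⟩

lemma shiftSet_injOn (F : Finset (Finset ℕ)) (I J : Finset ℕ) :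
    Set.InjOn (shiftSet F I J) F := by
  intro A hA B hB hAB
  simp only [Finset.mem_coe] at hA hB
  simp only [shiftSet, ← Finset.disjoint_iff_inter_eq_empty] at hAB
  split_ifs at hAB with h1 h2 h2
  · ext x
    have := congrArg (x ∈ ·) hAB
    have := Finset.disjoint_left.1 h1.1
    have := Finset.disjoint_left.1 h2.1
    grind
  · exact absurd (hAB ▸ hB) h1.2.2
  · exact absurd (hAB ▸ hA) h2.2.2
  · exact hAB

lemma card_shiftFam (I J : Finset ℕ) (F : Finset (Finset ℕ)) :
    (shiftFam I J F).card = F.card :=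
  Finset.card_image_of_injOn (shiftSet_injOn F I J)

lemma shiftStable_downClo {X I J : Finset ℕ} {F : Finset (Finset ℕ)} (hIX : I ⊆ X)
    (h : ∀ I' ⊆ I, I'.Nonempty → ShiftStable I' J F) : ShiftStable I J (downClo X F) := by
  intro C hC hIC hJC
  simp only [downClo, Finset.mem_filter, Finset.mem_powerset] at hC ⊢
  obtain ⟨hCX, B, hB, hCB⟩ := hC
  refine ⟨by grind, ?_⟩
  rcases (I \ B).eq_empty_or_nonempty with h0 | h0
  · rw [Finset.sdiff_eq_empty_iff_subset] at h0
    exact ⟨B, hB, by simp only [Finset.subset_iff, Finset.disjoint_left] at *; grind⟩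
  · exact ⟨_, h _ Finset.sdiff_subset h0 B hB Finset.sdiff_disjoint (hJC.trans hCB),
      by simp only [Finset.subset_iff, Finset.disjoint_left] at *; grind⟩

lemma shiftStable_upClo {X I J : Finset ℕ} {F : Finset (Finset ℕ)} (hIX : I ⊆ X)
    (h : ∀ J' ⊆ J, J'.Nonempty → ShiftStable I J' F) : ShiftStable I J (upClo X F) := by
  intro C hC hIC hJC
  simp only [upClo, Finset.mem_filter, Finset.mem_powerset] at hC ⊢
  obtain ⟨hCX, B, hB, hBC⟩ := hC
  refine ⟨by grind, ?_⟩
  rcases (J ∩ B).eq_empty_or_nonempty with h0 | h0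
  · rw [← Finset.disjoint_iff_inter_eq_empty, Finset.disjoint_left] at h0
    exact ⟨B, hB, by simp only [Finset.subset_iff, Finset.disjoint_left] at *; grind⟩
  · exact ⟨_, h _ Finset.inter_subset_left h0 B hB (hIC.mono_right hBC)
      Finset.inter_subset_right, by simp only [Finset.subset_iff, Finset.disjoint_left] at *; grind⟩

lemma downClo_shiftFam_subset {X I J : Finset ℕ} {F : Finset (Finset ℕ)} (hIX : I ⊆ X)
    (hJX : J ⊆ X) (hI : I.Nonempty) (hJ : J.Nonempty) (hIJ : Disjoint I J)
    (h : ∀ I' ⊂ I, I'.Nonempty → ShiftStable I' J F) :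
    downClo X (shiftFam I J F) ⊆ shiftFam I J (downClo X F) := by
  intro C hC
  simp only [downClo, Finset.mem_filter, Finset.mem_powerset] at hC
  obtain ⟨hCX, B, hB, hCB⟩ := hC
  rw [mem_shiftFam hI hIJ] at hB ⊢
  simp only [downClo, Finset.mem_filter, Finset.mem_powerset]
  rcases hB with ⟨hB, hB'⟩ | ⟨hIB, hJB, hA⟩
  · refine Or.inl ⟨⟨hCX, B, hB, hCB⟩, fun hIC hJC => ⟨by grind, ?_⟩⟩
    by_cases hd : Disjoint I B
    · exact ⟨_, hB' hd (hJC.trans hCB),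
        by simp only [Finset.subset_iff, Finset.disjoint_left] at *; grind⟩
    rcases (I \ B).eq_empty_or_nonempty with h0 | h0
    · rw [Finset.sdiff_eq_empty_iff_subset] at h0
      exact ⟨B, hB, by simp only [Finset.subset_iff, Finset.disjoint_left] at *; grind⟩
    · refine ⟨_, h (I \ B) ?_ h0 B hB Finset.sdiff_disjoint (hJC.trans hCB),
        by simp only [Finset.subset_iff, Finset.disjoint_left] at *; grind⟩
      refine Finset.sdiff_subset.ssubset_of_ne fun he => hd ?_
      rw [← he]
      exact Finset.sdiff_disjoint
  · by_cases hIC : I ⊆ C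
    · exact Or.inr ⟨hIC, hJB.mono_right hCB, by grind, _, hA,
        by simp only [Finset.subset_iff, Finset.disjoint_left] at *; grind⟩
    left
    refine ⟨⟨hCX, ?_⟩, fun _ hJC => ?_⟩
    · rcases (I ∩ C).eq_empty_or_nonempty with h0 | h0
      · rw [← Finset.disjoint_iff_inter_eq_empty, Finset.disjoint_left] at h0
        exact ⟨_, hA, by simp only [Finset.subset_iff, Finset.disjoint_left] at *; grind⟩
      · refine ⟨_, h (I ∩ C) ?_ h0 _ hA ?_ Finset.subset_union_right, ?_⟩
        · refine Finset.inter_subset_left.ssubset_of_ne fun he => hIC ?_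
          exact Finset.inter_eq_left.1 he
        · rw [Finset.disjoint_left] at hIJ ⊢
          grind
        · rw [Finset.disjoint_left] at hJB
          intro x hx
          have := hCB hx
          grind
    · obtain ⟨j, hj⟩ := hJ
      exact absurd (hCB (hJC hj)) (Finset.disjoint_left.1 hJB hj)

lemma upClo_shiftFam_subset {X I J : Finset ℕ} {F : Finset (Finset ℕ)} (hIX : I ⊆ X)
    (hJX : J ⊆ X) (hI : I.Nonempty) (hIJ : Disjoint I J)
    (h : ∀ J' ⊂ J, J'.Nonempty → ShiftStable I J' F) :
    upClo X (shiftFam I J F) ⊆ shiftFam I J (upClo X F) := by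
  intro C hC
  simp only [upClo, Finset.mem_filter, Finset.mem_powerset] at hC
  obtain ⟨hCX, B, hB, hBC⟩ := hC
  rw [mem_shiftFam hI hIJ] at hB ⊢
  simp only [upClo, Finset.mem_filter, Finset.mem_powerset]
  rcases hB with ⟨hB, hB'⟩ | ⟨hIB, hJB, hA⟩
  · refine Or.inl ⟨⟨hCX, B, hB, hBC⟩, fun hIC hJC => ⟨by grind, ?_⟩⟩
    by_cases hd : J ⊆ B
    · exact ⟨_, hB' (hIC.mono_right hBC) hd,
        by simp only [Finset.subset_iff, Finset.disjoint_left] at *; grind⟩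
    rcases (J ∩ B).eq_empty_or_nonempty with h0 | h0
    · rw [← Finset.disjoint_iff_inter_eq_empty, Finset.disjoint_left] at h0
      exact ⟨B, hB, by simp only [Finset.subset_iff, Finset.disjoint_left] at *; grind⟩
    · refine ⟨_, h (J ∩ B) ?_ h0 B hB (hIC.mono_right hBC) Finset.inter_subset_right,
        by simp only [Finset.subset_iff, Finset.disjoint_left] at *; grind⟩
      exact Finset.inter_subset_left.ssubset_of_ne fun he => hd (Finset.inter_eq_left.1 he)
  · have hIC : I ⊆ C := hIB.trans hBC
    by_cases hJC : Disjoint J C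
    · exact Or.inr ⟨hIC, hJC, by grind, _, hA,
        by simp only [Finset.subset_iff, Finset.disjoint_left] at *; grind⟩
    left
    refine ⟨⟨hCX, ?_⟩, fun hd => ?_⟩
    · rcases (J \ C).eq_empty_or_nonempty with h0 | h0
      · rw [Finset.sdiff_eq_empty_iff_subset] at h0
        exact ⟨_, hA, by simp only [Finset.subset_iff, Finset.disjoint_left] at *; grind⟩
      · refine ⟨_, h (J \ C) ?_ h0 _ hA ?_
          (by simp only [Finset.subset_iff, Finset.disjoint_left] at *; grind),
          by simp only [Finset.subset_iff, Finset.disjoint_left] at *; grind⟩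
        · refine Finset.sdiff_subset.ssubset_of_ne fun he => hJC ?_
          rw [← he]
          exact Finset.sdiff_disjoint
        · rw [Finset.disjoint_left] at hIJ ⊢
          grind
    · obtain ⟨i, hi⟩ := hI
      exact absurd (hIC hi) (Finset.disjoint_left.1 hd hi)

lemma card_udClo_shiftFam_le {X I J : Finset ℕ} {F : Finset (Finset ℕ)} (hIX : I ⊆ X)
    (hJX : J ⊆ X) (hI : I.Nonempty) (hJ : J.Nonempty) (hIJ : Disjoint I J)
    (hdown : ∀ I' ⊂ I, I'.Nonempty → ShiftStable I' J F)
    (hup : ∀ J' ⊂ J, J'.Nonempty → ShiftStable I J' F) :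
    (udClo X (shiftFam I J F)).card ≤ (udClo X F).card := by
  rw [← card_shiftFam I J (udClo X F)]
  refine Finset.card_le_card (Finset.union_subset ?_ ?_)
  · exact (upClo_shiftFam_subset hIX hJX hI hIJ hup).trans
      (shiftFam_mono hI hIJ Finset.subset_union_left)
  · exact (downClo_shiftFam_subset hIX hJX hI hJ hIJ hdown).trans
      (shiftFam_mono hI hIJ Finset.subset_union_right)

/-- A weight on subsets of `[n]` that increases along inclusions and along shifts. -/
def lexWeight (n : ℕ) (A : Finset ℕ) : ℕ := ∑ i ∈ A, 2 ^ (n - i)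

lemma lexWeight_lt_of_ssubset (n : ℕ) {A B : Finset ℕ} (h : A ⊂ B) :
    lexWeight n A < lexWeight n B := by
  obtain ⟨b, hb, hbA⟩ := Finset.exists_of_ssubset h
  exact Finset.sum_lt_sum_of_subset h.1 hb hbA (by positivity) fun _ _ _ => Nat.zero_le _

lemma IsShiftPair.lexWeight_lt {n : ℕ} {I J : Finset ℕ} (h : IsShiftPair n I J) :
    lexWeight n J < lexWeight n I := by
  obtain ⟨i, hi⟩ := h.left_nonempty
  have hJ : ∀ j ∈ J, j ≤ n := fun j hj => (Finset.mem_Icc.1 (h.right_subset hj)).2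
  have hinj : Set.InjOn (fun j => n - j) (J : Set ℕ) := by
    intro a ha b hb hab
    have := hJ a ha
    have := hJ b hb
    simp only at hab
    omega
  calc lexWeight n J = ∑ k ∈ J.image (fun j => n - j), 2 ^ k := by
        rw [lexWeight, Finset.sum_image hinj]
    _ < 2 ^ (n - i) := by
        refine Nat.geomSum_lt le_rfl fun k hk => ?_
        obtain ⟨j, hj, rfl⟩ := Finset.mem_image.1 hk
        have := h.lt i hi j hj
        have := hJ j hj
        omega
    _ ≤ lexWeight n I :=
        Finset.single_le_sum (f := fun i => 2 ^ (n - i)) (fun _ _ => Nat.zero_le _) hi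

lemma IsShiftPair.lexWeight_lt_shift {n : ℕ} {I J A : Finset ℕ} (h : IsShiftPair n I J)
    (hIA : Disjoint I A) (hJA : J ⊆ A) : lexWeight n A < lexWeight n ((A \ J) ∪ I) := by
  have h1 : lexWeight n ((A \ J) ∪ I) = lexWeight n (A \ J) + lexWeight n I :=
    Finset.sum_union (hIA.symm.mono_left Finset.sdiff_subset)
  have h2 : lexWeight n (A \ J) + lexWeight n J = lexWeight n A := Finset.sum_sdiff hJA
  have := h.lexWeight_lt
  omega

lemma IsShiftPair.sum_lexWeight_lt {n : ℕ} {I J : Finset ℕ} {F : Finset (Finset ℕ)}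
    (h : IsShiftPair n I J) (hF : ¬ ShiftStable I J F) :
    ∑ A ∈ F, lexWeight n A < ∑ A ∈ shiftFam I J F, lexWeight n A := by
  rw [shiftFam, Finset.sum_image (shiftSet_injOn F I J)]
  unfold ShiftStable at hF
  push Not at hF
  obtain ⟨A, hA, hIA, hJA, hAF⟩ := hF
  refine Finset.sum_lt_sum (fun B _ => ?_) ⟨A, hA, ?_⟩
  · unfold shiftSet
    split_ifs with hB
    · exact (h.lexWeight_lt_shift (Finset.disjoint_iff_inter_eq_empty.2 hB.1) hB.2.1).le
    · exact le_rfl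
  · rw [shiftSet, if_pos ⟨Finset.disjoint_iff_inter_eq_empty.1 hIA, hJA, hAF⟩]
    exact h.lexWeight_lt_shift hIA hJA

lemma shiftFam_subset_powerset {X I J : Finset ℕ} {F : Finset (Finset ℕ)} (hIX : I ⊆ X)
    (hF : F ⊆ X.powerset) : shiftFam I J F ⊆ X.powerset := by
  intro B hB
  obtain ⟨A, hA, rfl⟩ := Finset.mem_image.1 hB
  have hAX := Finset.mem_powerset.1 (hF hA)
  rw [Finset.mem_powerset, shiftSet]
  split_ifs
  · exact Finset.union_subset (Finset.sdiff_subset.trans hAX) hIX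
  · exact hAX

lemma Phi_le {n : ℕ} {F : Finset (Finset ℕ)} (hF : F ⊆ (groundSet n).powerset) :
    Phi n F.card ≤ (udClo (groundSet n) F).card :=
  Nat.sInf_le ⟨F, hF, rfl, rfl⟩

lemma exists_card_udClo_eq_Phi {n m : ℕ} (hm : m ≤ 2 ^ n) :
    ∃ F : Finset (Finset ℕ), F ⊆ (groundSet n).powerset ∧ F.card = m ∧
      (udClo (groundSet n) F).card = Phi n m := by
  refine Nat.sInf_mem (s := {k | ∃ F : Finset (Finset ℕ),
    F ⊆ (groundSet n).powerset ∧ F.card = m ∧ (udClo (groundSet n) F).card = k}) ?_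
  obtain ⟨F, hF, hFm⟩ := Finset.exists_subset_card_eq
    (s := (groundSet n).powerset) (n := m) (by simpa [groundSet] using hm)
  exact ⟨_, F, hF, hFm, rfl⟩

lemma exists_shiftStable_card_udClo_eq_Phi {n m : ℕ} (hm : m ≤ 2 ^ n) :
    ∃ F : Finset (Finset ℕ), F ⊆ (groundSet n).powerset ∧ F.card = m ∧
      (udClo (groundSet n) F).card = Phi n m ∧
      ∀ I J, IsShiftPair n I J → ShiftStable I J F := by
  classical
  obtain ⟨F, hF, hmax⟩ := Finset.exists_max_image
    ((groundSet n).powerset.powerset.filter fun F =>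
      F.card = m ∧ (udClo (groundSet n) F).card = Phi n m)
    (fun F => ∑ A ∈ F, lexWeight n A)
    (by
      obtain ⟨F, hF⟩ := exists_card_udClo_eq_Phi hm
      exact ⟨F, by simpa using hF⟩)
  simp only [Finset.mem_filter, Finset.mem_powerset] at hF hmax
  obtain ⟨hFX, hFm, hFΦ⟩ := hF
  refine ⟨F, hFX, hFm, hFΦ, ?_⟩
  suffices ∀ k I J, I.card + J.card = k → IsShiftPair n I J → ShiftStable I J F from
    fun I J => this _ I J rfl
  intro k
  induction k using Nat.strong_induction_on with
  | _ k ih =>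
    intro I J hk hp
    by_contra hns
    refine (hp.sum_lexWeight_lt hns).not_ge (hmax _ ?_)
    have hsub := shiftFam_subset_powerset (J := J) hp.left_subset hFX
    have hcard := (card_shiftFam I J F).trans hFm
    refine ⟨hsub, hcard, le_antisymm ?_ ?_⟩
    · rw [← hFΦ]
      refine card_udClo_shiftFam_le hp.left_subset hp.right_subset hp.left_nonempty
        hp.right_nonempty hp.disjoint (fun I' hI' h0 => ?_) (fun J' hJ' h0 => ?_)
      · have := Finset.card_lt_card hI'
        exact ih _ (by omega) I' J rfl (hp.mono hI'.1 subset_rfl h0 hp.right_nonempty)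
      · have := Finset.card_lt_card hJ'
        exact ih _ (by omega) I J' rfl (hp.mono subset_rfl hJ'.1 hp.left_nonempty h0)
    · rw [← hcard]
      exact Phi_le hsub

lemma upClo_mono (X : Finset ℕ) {F G : Finset (Finset ℕ)} (h : F ⊆ G) :
    upClo X F ⊆ upClo X G :=
  Finset.monotone_filter_right _ fun _ _ ⟨A, hA, hAS⟩ => ⟨A, h hA, hAS⟩

lemma downClo_mono (X : Finset ℕ) {F G : Finset (Finset ℕ)} (h : F ⊆ G) :
    downClo X F ⊆ downClo X G :=
  Finset.monotone_filter_right _ fun _ _ ⟨A, hA, hAS⟩ => ⟨A, h hA, hAS⟩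

lemma udClo_mono (X : Finset ℕ) {F G : Finset (Finset ℕ)} (h : F ⊆ G) :
    udClo X F ⊆ udClo X G :=
  Finset.union_subset_union (upClo_mono X h) (downClo_mono X h)

lemma subset_upClo_inter_downClo {X : Finset ℕ} {F : Finset (Finset ℕ)} (hF : F ⊆ X.powerset) :
    F ⊆ upClo X F ∩ downClo X F := fun A hA =>
  Finset.mem_inter.2 ⟨Finset.mem_filter.2 ⟨hF hA, A, hA, subset_rfl⟩,
    Finset.mem_filter.2 ⟨hF hA, A, hA, subset_rfl⟩⟩

lemma upClo_upClo_subset (X : Finset ℕ) (F : Finset (Finset ℕ)) :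
    upClo X (upClo X F) ⊆ upClo X F := by
  intro S hS
  obtain ⟨hS, A, hA, hAS⟩ := Finset.mem_filter.1 hS
  obtain ⟨_, B, hB, hBA⟩ := Finset.mem_filter.1 hA
  exact Finset.mem_filter.2 ⟨hS, B, hB, hBA.trans hAS⟩

lemma downClo_downClo_subset (X : Finset ℕ) (F : Finset (Finset ℕ)) :
    downClo X (downClo X F) ⊆ downClo X F := by
  intro S hS
  obtain ⟨hS, A, hA, hSA⟩ := Finset.mem_filter.1 hS
  obtain ⟨_, B, hB, hAB⟩ := Finset.mem_filter.1 hA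
  exact Finset.mem_filter.2 ⟨hS, B, hB, hSA.trans hAB⟩

lemma upClo_hull_subset (X : Finset ℕ) (F : Finset (Finset ℕ)) :
    upClo X (upClo X F ∩ downClo X F) ⊆ upClo X F :=
  (upClo_mono X Finset.inter_subset_left).trans (upClo_upClo_subset X F)

lemma downClo_hull_subset (X : Finset ℕ) (F : Finset (Finset ℕ)) :
    downClo X (upClo X F ∩ downClo X F) ⊆ downClo X F :=
  (downClo_mono X Finset.inter_subset_right).trans (downClo_downClo_subset X F)

lemma isConvex_hull (X : Finset ℕ) (F : Finset (Finset ℕ)) :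
    IsConvex X (upClo X F ∩ downClo X F) :=
  (Finset.inter_subset_inter (upClo_hull_subset X F) (downClo_hull_subset X F)).antisymm
    (subset_upClo_inter_downClo fun _ h =>
      (Finset.mem_filter.1 (Finset.mem_inter.1 h).1).1)

/-- Removing an inclusion-minimal member preserves convexity. -/
lemma IsConvex.erase {X A : Finset ℕ} {F : Finset (Finset ℕ)} (h : IsConvex X F)
    (hF : F ⊆ X.powerset) (hA : ∀ B ∈ F, ¬ B ⊂ A) : IsConvex X (F.erase A) := by
  refine Finset.Subset.antisymm (fun S hS => Finset.mem_erase.2 ⟨?_, ?_⟩)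
    (subset_upClo_inter_downClo ((Finset.erase_subset _ _).trans hF))
  · rintro rfl
    obtain ⟨B, hB, hBS⟩ := (Finset.mem_filter.1 (Finset.mem_inter.1 hS).1).2
    rw [Finset.mem_erase] at hB
    exact hA B hB.2 (hBS.ssubset_of_ne hB.1)
  · rw [← show _ = F from h]
    exact Finset.inter_subset_inter (upClo_mono X (Finset.erase_subset _ _))
      (downClo_mono X (Finset.erase_subset _ _)) hS

lemma exists_subset_isConvex_shiftStable {n m : ℕ} {C : Finset (Finset ℕ)}
    (hC : C ⊆ (groundSet n).powerset) (hconv : IsConvex (groundSet n) C)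
    (hst : ∀ I J, IsShiftPair n I J → ShiftStable I J C) (hm : m ≤ C.card) :
    ∃ D ⊆ C, D.card = m ∧ IsConvex (groundSet n) D ∧
      ∀ I J, IsShiftPair n I J → ShiftStable I J D := by
  induction C using Finset.strongInduction with
  | H C ih =>
    rcases hm.eq_or_lt with rfl | hlt
    · exact ⟨C, subset_rfl, rfl, hconv, hst⟩
    obtain ⟨A, hA, hmin⟩ := Finset.exists_min_image C (lexWeight n)
      (Finset.card_pos.1 (by omega))
    obtain ⟨D, hD, h⟩ := ih (C.erase A) (Finset.erase_ssubset hA)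
      ((Finset.erase_subset _ _).trans hC)
      (hconv.erase hC fun B hB hBA => (lexWeight_lt_of_ssubset n hBA).not_ge (hmin B hB))
      (fun I J hp B hB hIB hJB => by
        replace hB := Finset.mem_of_mem_erase hB
        refine Finset.mem_erase.2 ⟨?_, hst I J hp B hB hIB hJB⟩
        intro hBA
        exact (hp.lexWeight_lt_shift hIB hJB).not_ge (hBA ▸ hmin B hB))
      (by rw [Finset.card_erase_of_mem hA]; omega)
    exact ⟨D, hD.trans (Finset.erase_subset _ _), h⟩

/-- Lemma 10: there exists an `(n,m)`-witness family that is convex and strongly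
shifted. -/
theorem stmt9 (n m : ℕ) (hm : m ≤ 2 ^ n) :
    ∃ F : Finset (Finset ℕ), F ⊆ (groundSet n).powerset ∧ F.card = m ∧
      (udClo (groundSet n) F).card = Phi n m ∧
      IsConvex (groundSet n) F ∧ StronglyShifted n F := by
  obtain ⟨F, hF, rfl, hFΦ, hst⟩ := exists_shiftStable_card_udClo_eq_Phi hm
  set X := groundSet n
  have hC : upClo X F ∩ downClo X F ⊆ X.powerset := fun _ h =>
    (Finset.mem_filter.1 (Finset.mem_inter.1 h).1).1
  obtain ⟨D, hD, hDm, hDconv, hDst⟩ := exists_subset_isConvex_shiftStable hC (isConvex_hull X F)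
    (fun I J hp A hA hIA hJA => by
      rw [Finset.mem_inter] at hA ⊢
      exact ⟨shiftStable_upClo hp.left_subset
          (fun J' hJ' h0 => hst I J' (hp.mono subset_rfl hJ' hp.left_nonempty h0))
          A hA.1 hIA hJA,
        shiftStable_downClo hp.left_subset
          (fun I' hI' h0 => hst I' J (hp.mono hI' subset_rfl h0 hp.right_nonempty))
          A hA.2 hIA hJA⟩)
    (Finset.card_le_card (subset_upClo_inter_downClo hF))
  refine ⟨D, hD.trans hC, hDm, le_antisymm ?_ ?_, hDconv, stronglyShifted_of_shiftStable hDst⟩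
  · rw [← hFΦ]
    exact Finset.card_le_card ((udClo_mono X hD).trans
      (Finset.union_subset_union (upClo_hull_subset X F) (downClo_hull_subset X F)))
  · rw [← hDm]
    exact Phi_le (hD.trans hC)
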